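/- For each fixed even natural number k = 2n (n ≥ 1) and every real x ≥ k+1, the following double inequality holds: r_k(x) < F(x)/Γ(x+2) ≤ (p_k(x)/(p_k(x)−1))·r_k(x), where the right inequality is an equality if and only if x = k+1. -/

import Mathlib

open MeasureTheory

/-- The real part of the alternating Kurepa function:
`F(x) = ∫₀^∞ e^{−t} (t^{x+1} − cos(πx)·t)/(t+1) dt`, convergent for `x > −2`. -/
noncomputable def reAltKurepa (x : ℝ) : ℝ :=
  ∫ t in Set.Ioi (0 : ℝ), Real.exp (-t) * (t ^ (x + 1) - Real.cos (Real.pi * x) * t) / (t + 1)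

/-- The polynomials `pₙ` (real version), defined recursively by `p₀(z) = 1` and
`pₙ(z) = (z − n + 1)·pₙ₋₁(z) + (−1)ⁿ` for `n ≥ 1`. -/
noncomputable def kurepaP : ℕ → ℝ → ℝ
  | 0, _ => 1
  | (n + 1), z => (z - ((n : ℝ) + 1) + 1) * kurepaP n z + (-1 : ℝ) ^ (n + 1)

/-- The rational functions `rₙ` (real version): `r₁(z) = −1/(z+1)`, `r₂(z) = (z−1)/(z(z+1))`,
and `rₙ(z) = −((z−n+1)/(z−n+2))·rₙ₋₁(z) + (1/(z−n+2))·rₙ₋₂(z)` for `n ≥ 3`.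
(The value of `r₀` is an irrelevant junk value.) -/
noncomputable def kurepaR : ℕ → ℝ → ℝ
  | 0, _ => 0
  | 1, z => -1 / (z + 1)
  | 2, z => (z - 1) / (z * (z + 1))
  | (n + 3), z =>
      -((z - ((n : ℝ) + 3) + 1) / (z - ((n : ℝ) + 3) + 2)) * kurepaR (n + 2) z +
        (1 / (z - ((n : ℝ) + 3) + 2)) * kurepaR (n + 1) z

lemma integrableOn_exp_neg_mul_rpow {a : ℝ} (ha : -1 < a) :
    IntegrableOn (fun t : ℝ => Real.exp (-t) * t ^ a) (Set.Ioi 0) := by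
  have h := Real.GammaIntegral_convergent (s := a + 1) (by linarith)
  simpa using h

lemma integrableOn_exp_neg_mul_rpow_div {a : ℝ} (ha : -1 < a) :
    IntegrableOn (fun t : ℝ => Real.exp (-t) * t ^ a / (t + 1)) (Set.Ioi 0) := by
  refine Integrable.mono' (integrableOn_exp_neg_mul_rpow ha) ?_ ?_
  · exact (Measurable.aestronglyMeasurable (by fun_prop))
  · refine (ae_restrict_iff' measurableSet_Ioi).2 (Filter.Eventually.of_forall fun t ht => ?_)
    have ht : 0 < t := ht
    have h : 0 ≤ Real.exp (-t) * t ^ a := by positivity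
    rw [Real.norm_of_nonneg (by positivity)]
    exact div_le_self h (by linarith)

lemma integrableOn_reAltKurepa_integrand {x : ℝ} (hx : -2 < x) (c : ℝ) :
    IntegrableOn (fun t : ℝ => Real.exp (-t) * (t ^ (x + 1) - c * t) / (t + 1)) (Set.Ioi 0) := by
  have h1 := integrableOn_exp_neg_mul_rpow_div (a := x + 1) (by linarith)
  have h2 := (integrableOn_exp_neg_mul_rpow_div (a := 1) (by norm_num)).const_mul c
  refine (h1.sub h2).congr (Filter.Eventually.of_forall fun t => ?_)
  simp only [Pi.sub_apply, Real.rpow_one]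
  ring

lemma reAltKurepa_zero : reAltKurepa 0 = 0 := by
  simp [reAltKurepa]

lemma reAltKurepa_add_sub_one {x : ℝ} (hx : -1 < x) :
    reAltKurepa x + reAltKurepa (x - 1) = Real.Gamma (x + 1) := by
  have hc : Real.cos (Real.pi * (x - 1)) = -Real.cos (Real.pi * x) := by
    rw [mul_sub, mul_one, Real.cos_sub_pi]
  rw [reAltKurepa, reAltKurepa, Real.Gamma_eq_integral (by linarith), ← integral_add
    (integrableOn_reAltKurepa_integrand (by linarith) _)
    (integrableOn_reAltKurepa_integrand (by linarith) _)]
  refine setIntegral_congr_fun measurableSet_Ioi fun t ht => ?_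
  have ht : 0 < t := ht
  simp only [hc, sub_add_cancel, add_sub_cancel_right, Real.rpow_add_one ht.ne']
  field_simp
  ring

lemma exp_neg_div_add_one_le_quadratic {t : ℝ} (h0 : 0 ≤ t) :
    Real.exp (-t) / (t + 1) ≤ 1 - 3 / 2 * t + 3 / 4 * t ^ 2 := by
  have hq := Real.quadratic_le_exp_of_nonneg h0
  have hA : 0 < 1 - 3 / 2 * t + 3 / 4 * t ^ 2 := by nlinarith [sq_nonneg (t - 1)]
  rw [Real.exp_neg, div_le_iff₀ (by linarith), inv_le_iff_one_le_mul₀ (Real.exp_pos t)]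
  have hpoly : 0 ≤ 1 / 2 - 3 / 4 * t - 1 / 4 * t ^ 2 + 3 / 8 * t ^ 3 + 3 / 8 * t ^ 4 := by
    nlinarith [sq_nonneg (t ^ 2 + t / 2 - 9 / 10), sq_nonneg (t - 3 / 4)]
  have hB : 0 ≤ (1 - 3 / 2 * t + 3 / 4 * t ^ 2) * (t + 1) := by positivity
  have := mul_le_mul_of_nonneg_left hq hB
  nlinarith [mul_nonneg h0 hpoly]

lemma cubic_le_mul_log {u : ℝ} (hu : 1 ≤ u) :
    (u ^ 2 - 1) * (11 - u) / 20 ≤ u * Real.log u := by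
  let h : ℝ → ℝ := fun v => Real.log v - (11 * v - 11 * v⁻¹ - v ^ 2 + 1) / 20
  have hd : ∀ v : ℝ, 0 < v → HasDerivAt h
      (v⁻¹ - (11 * 1 - 11 * (-(v ^ 2)⁻¹) - 2 * v) / 20) v := fun v hv => by
    have := (Real.hasDerivAt_log hv.ne').sub
      ((((((hasDerivAt_id v).const_mul 11).sub ((hasDerivAt_inv hv.ne').const_mul 11)).sub
        (hasDerivAt_pow 2 v)).add_const 1).div_const 20)
    exact this.congr_deriv (by simp)
  have hm : MonotoneOn h (Set.Ici 1) := by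
    refine monotoneOn_of_hasDerivWithinAt_nonneg (convex_Ici 1)
      (fun v hv => (hd v (by linarith [Set.mem_Ici.1 hv])).continuousAt.continuousWithinAt)
      (fun v hv => (hd v ?_).hasDerivWithinAt) (fun v hv => ?_)
    · rw [interior_Ici, Set.mem_Ioi] at hv; linarith
    · rw [interior_Ici, Set.mem_Ioi] at hv
      have hv0 : 0 < v := by linarith
      have : v⁻¹ - (11 * 1 - 11 * (-(v ^ 2)⁻¹) - 2 * v) / 20
          = (v - 1) * (2 * v ^ 2 - 9 * v + 11) / (20 * v ^ 2) := by
        field_simp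
        ring
      rw [this]
      have : 0 ≤ 2 * v ^ 2 - 9 * v + 11 := by nlinarith [sq_nonneg (v - 9 / 4)]
      have : 0 ≤ v - 1 := by linarith
      positivity
  have h1 := hm (Set.mem_Ici.2 le_rfl) (Set.mem_Ici.2 hu) hu
  have hu0 : 0 < u := by linarith
  simp only [h, Real.log_one] at h1
  have h2 := mul_le_mul_of_nonneg_left h1 hu0.le
  have h3 : u * (Real.log u - (11 * u - 11 * u⁻¹ - u ^ 2 + 1) / 20)
      = u * Real.log u - (u ^ 2 - 1) * (11 - u) / 20 := by
    field_simp
    ring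
  rw [h3] at h2
  norm_num at h2
  linarith

lemma setIntegral_mul_log_mul_quadratic :
    ∫ t in Set.Ioc (0 : ℝ) 1, t * Real.log t * (1 - 3 / 2 * t + 3 / 4 * t ^ 2) = -(25 / 192) := by
  have hcont : Continuous fun t : ℝ => t * Real.log t * (1 - 3 / 2 * t + 3 / 4 * t ^ 2) :=
    Real.continuous_mul_log.mul (by fun_prop)
  rw [← intervalIntegral.integral_of_le zero_le_one,
    intervalIntegral.integral_eq_sub_of_hasDerivAt_of_le zero_le_one
      (f := fun t => t * Real.log t * (t / 2 - t ^ 2 / 2 + 3 / 16 * t ^ 3)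
        - (t ^ 2 / 4 - t ^ 3 / 6 + 3 / 64 * t ^ 4)) ?_ ?_ (hcont.intervalIntegrable _ _)]
  · norm_num
  · exact ((Real.continuous_mul_log.mul (by fun_prop)).sub (by fun_prop)).continuousOn
  · intro t ht
    have h := ((Real.hasDerivAt_mul_log ht.1.ne').mul
      ((((hasDerivAt_id t).div_const 2).sub ((hasDerivAt_pow 2 t).div_const 2)).add
        ((hasDerivAt_pow 3 t).const_mul (3 / 16)))).sub
      ((((hasDerivAt_pow 2 t).div_const 4).sub ((hasDerivAt_pow 3 t).div_const 6)).add
        ((hasDerivAt_pow 4 t).const_mul (3 / 64)))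
    refine h.congr_deriv ?_
    simp only [Pi.add_apply, Pi.sub_apply, id]
    push_cast
    ring

lemma integrableOn_exp_neg_mul_quadratic :
    IntegrableOn (fun t : ℝ => Real.exp (-t) * ((t - 1) / 2 - (t - 1) ^ 2 / 20)) (Set.Ioi 1) := by
  have h (n : ℕ) : IntegrableOn (fun t : ℝ => Real.exp (-t) * t ^ n) (Set.Ioi 1) := by
    have := integrableOn_exp_neg_mul_rpow (a := n) (by linarith [n.cast_nonneg (α := ℝ)])
    simp only [Real.rpow_natCast] at this
    exact this.mono_set (Set.Ioi_subset_Ioi zero_le_one)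
  refine ((((h 0).const_mul (-(11 / 20))).add ((h 1).const_mul (3 / 5))).sub
    ((h 2).const_mul (1 / 20))).congr (Filter.Eventually.of_forall fun t => ?_)
  simp only [Pi.add_apply, Pi.sub_apply]
  ring

lemma setIntegral_exp_neg_mul_quadratic :
    ∫ t in Set.Ioi (1 : ℝ), Real.exp (-t) * ((t - 1) / 2 - (t - 1) ^ 2 / 20)
      = 2 / 5 * Real.exp (-1) := by
  have hlim (n : ℕ) : Filter.Tendsto (fun t : ℝ => t ^ n * Real.exp (-t)) Filter.atTop (nhds 0) :=
    Real.tendsto_pow_mul_exp_neg_atTop_nhds_zero n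
  have hT : Filter.Tendsto (fun t : ℝ => Real.exp (-t) *
      -(2 / 5 + 2 / 5 * (t - 1) - (t - 1) ^ 2 / 20)) Filter.atTop (nhds 0) := by
    have := (((hlim 0).const_mul (1 / 20)).sub ((hlim 1).const_mul (1 / 2))).add
      ((hlim 2).const_mul (1 / 20))
    refine (this.congr fun t => ?_).trans (by simp)
    ring
  rw [integral_Ioi_of_hasDerivAt_of_tendsto' (fun t _ => ?_) integrableOn_exp_neg_mul_quadratic hT]
  · ring
  · have h := (hasDerivAt_neg t).exp.mul
      (((((hasDerivAt_id t).sub_const 1).const_mul (2 / 5)).const_add (2 / 5)).sub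
        ((((hasDerivAt_id t).sub_const 1).pow 2).div_const 20)).neg
    refine h.congr_deriv ?_
    simp only [Pi.neg_apply, Pi.sub_apply, Pi.pow_apply, id]
    push_cast
    ring

lemma mul_mul_log_div_le_reAltKurepa_integrand {t : ℝ} (ht : 0 < t) (x : ℝ) :
    x * (Real.exp (-t) / (t + 1) * (t * Real.log t)) ≤
      Real.exp (-t) * (t ^ (x + 1) - Real.cos (Real.pi * x) * t) / (t + 1) := by
  have h1 : x * Real.log t + 1 ≤ t ^ x := by
    rw [Real.rpow_def_of_pos ht, mul_comm x]
    exact Real.add_one_le_exp _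
  have h2 := Real.cos_le_one (Real.pi * x)
  have h3 : 0 ≤ Real.exp (-t) / (t + 1) * t := by positivity
  rw [Real.rpow_add_one ht.ne']
  calc x * (Real.exp (-t) / (t + 1) * (t * Real.log t))
      = Real.exp (-t) / (t + 1) * t * (x * Real.log t) := by ring
    _ ≤ Real.exp (-t) / (t + 1) * t * (t ^ x - Real.cos (Real.pi * x)) :=
        mul_le_mul_of_nonneg_left (by linarith) h3
    _ = _ := by ring

lemma reAltKurepa_pos {x : ℝ} (hx : 0 < x) : 0 < reAltKurepa x := by
  have hint := integrableOn_reAltKurepa_integrand (x := x) (by linarith) (Real.cos (Real.pi * x))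
  have hi1 := hint.mono_set (Set.Ioc_subset_Ioi_self : Set.Ioc (0 : ℝ) 1 ⊆ _)
  have hi2 := hint.mono_set (Set.Ioi_subset_Ioi zero_le_one : Set.Ioi (1 : ℝ) ⊆ _)
  have hcont : Continuous fun t : ℝ => x * (t * Real.log t * (1 - 3 / 2 * t + 3 / 4 * t ^ 2)) :=
    continuous_const.mul (Real.continuous_mul_log.mul (by fun_prop))
  have hle1 := setIntegral_mono_on (hcont.integrableOn_Ioc (a := 0) (b := 1) (μ := volume))
    hi1 measurableSet_Ioc (fun t ht => by
      refine le_trans ?_ (mul_mul_log_div_le_reAltKurepa_integrand ht.1 x)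
      have hlog : t * Real.log t ≤ 0 :=
        mul_nonpos_of_nonneg_of_nonpos ht.1.le (Real.log_nonpos ht.1.le ht.2)
      refine mul_le_mul_of_nonneg_left ?_ hx.le
      rw [mul_comm (t * Real.log t)]
      exact mul_le_mul_of_nonpos_right (exp_neg_div_add_one_le_quadratic ht.1.le) hlog)
  have hle2 := setIntegral_mono_on (integrableOn_exp_neg_mul_quadratic.const_mul x)
    hi2 measurableSet_Ioi (fun t ht => by
      have ht : 1 < t := ht
      refine le_trans ?_ (mul_mul_log_div_le_reAltKurepa_integrand (by linarith) x)
      refine mul_le_mul_of_nonneg_left ?_ hx.le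
      rw [div_mul_eq_mul_div, mul_div_assoc]
      refine mul_le_mul_of_nonneg_left ?_ (Real.exp_pos _).le
      rw [le_div_iff₀ (by linarith)]
      linarith [cubic_le_mul_log ht.le])
  rw [integral_const_mul, setIntegral_mul_log_mul_quadratic] at hle1
  rw [integral_const_mul, setIntegral_exp_neg_mul_quadratic] at hle2
  have he : 1 / 3 < Real.exp (-1) := by
    rw [Real.exp_neg, ← one_div]
    exact one_div_lt_one_div_of_lt (Real.exp_pos 1) (by linarith [Real.exp_one_lt_d9])
  rw [reAltKurepa, ← Set.Ioc_union_Ioi_eq_Ioi (zero_le_one (α := ℝ)),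
    setIntegral_union (Set.Ioc_disjoint_Ioi le_rfl) measurableSet_Ioi hi1 hi2]
  nlinarith

lemma Gamma_add_two_eq_prod_mul (k : ℕ) {x : ℝ} (hx : (k : ℝ) - 1 < x) :
    Real.Gamma (x + 2) =
      (∏ j ∈ Finset.range (k + 1), (x + 1 - j)) * Real.Gamma (x + 1 - k) := by
  induction k with
  | zero =>
    push_cast at hx
    simp only [zero_add, Finset.prod_range_one, Nat.cast_zero, sub_zero]
    rw [← Real.Gamma_add_one (by linarith)]
    ring_nf
  | succ k ih =>
    push_cast at hx
    rw [ih (by linarith), Finset.prod_range_succ _ (k + 1)]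
    have := Real.Gamma_add_one (s := x - k) (by linarith)
    push_cast
    rw [show x + 1 - (k : ℝ) = x - k + 1 by ring, this]
    ring_nf

lemma kurepaR_mul_prod (k : ℕ) {x : ℝ} (hx : (k : ℝ) - 1 < x) :
    kurepaR (k + 1) x * ∏ j ∈ Finset.range (k + 1), (x + 1 - j) =
      (-1) ^ (k + 1) * kurepaP k x := by
  induction k using Nat.twoStepInduction with
  | zero =>
    push_cast at hx
    have : x + 1 ≠ 0 := by linarith
    simp [kurepaR, kurepaP, this]
  | one =>
    push_cast at hx
    have : x + 1 ≠ 0 := by linarith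
    have : x ≠ 0 := by linarith
    simp [kurepaR, kurepaP, Finset.prod_range_succ]
    field_simp
    ring
  | more n ih1 ih2 =>
    push_cast at hx ih1 ih2
    have h1 := ih1 (by linarith)
    have h2 := ih2 (by linarith)
    rw [Finset.prod_range_succ _ (n + 1)] at h2
    rw [Finset.prod_range_succ _ (n + 2), Finset.prod_range_succ _ (n + 1), kurepaR, kurepaP]
    rw [kurepaP] at h2 ⊢
    set D := ∏ j ∈ Finset.range (n + 1), (x + 1 - (j : ℝ))
    have hne : x - (n + 3) + 2 ≠ 0 := by linarith
    push_cast at h2 ⊢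
    have e : (-((x - ((n : ℝ) + 3) + 1) / (x - (n + 3) + 2)) * kurepaR (n + 2) x +
        1 / (x - (n + 3) + 2) * kurepaR (n + 1) x) * (D * (x + 1 - (n + 1)) * (x + 1 - (n + 2)))
        = -(x - (n + 3) + 1) * (kurepaR (n + 2) x * (D * (x + 1 - (n + 1))))
          + (kurepaR (n + 1) x * D) * (x - n) := by
      field_simp
      ring
    rw [e, h1, h2]
    ring

lemma reAltKurepa_eq_Gamma_mul_add (k : ℕ) {x : ℝ} (hx : (k : ℝ) < x) :
    reAltKurepa x = Real.Gamma (x + 2) *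
      (kurepaP k x / ∏ j ∈ Finset.range (k + 1), (x + 1 - j)) -
        (-1) ^ k * reAltKurepa (x - k - 1) := by
  induction k with
  | zero =>
    push_cast at hx
    have h := reAltKurepa_add_sub_one (x := x) (by linarith)
    have hG := Real.Gamma_add_one (s := x + 1) (by linarith)
    have : x + 1 ≠ 0 := by linarith
    rw [show x + 1 + 1 = x + 2 by ring] at hG
    simp only [kurepaP, hG, zero_add, Finset.prod_range_one, Nat.cast_zero, sub_zero, pow_zero]
    field_simp
    linarith
  | succ k ih =>
    push_cast at hx
    have h := reAltKurepa_add_sub_one (x := x - k - 1) (by linarith)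
    have hG := Gamma_add_two_eq_prod_mul (k + 1) (x := x) (by push_cast; linarith)
    have hD : ∏ j ∈ Finset.range (k + 1), (x + 1 - (j : ℝ)) ≠ 0 :=
      Finset.prod_ne_zero_iff.2 fun j hj => by
        have : (j : ℝ) ≤ k := by exact_mod_cast Nat.lt_succ_iff.1 (Finset.mem_range.1 hj)
        linarith
    rw [Finset.prod_range_succ] at hG ⊢
    rw [ih (by linarith), kurepaP, hG, eq_sub_of_add_eq h]
    push_cast
    have hx0 : x + 1 - ((k : ℝ) + 1) ≠ 0 := by linarith
    rw [show x - (k : ℝ) - 1 + 1 = x + 1 - (k + 1) by ring,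
      show x - ((k : ℝ) + 1) - 1 = x - k - 1 - 1 by ring]
    field_simp
    ring

lemma one_le_kurepaP (n : ℕ) {x : ℝ} (hx : (n : ℝ) + 1 ≤ x) : 1 ≤ kurepaP n x := by
  induction n with
  | zero => simp [kurepaP]
  | succ n ih =>
    push_cast at hx
    have h := ih (by linarith)
    have hs : -1 ≤ (-1 : ℝ) ^ (n + 1) := (abs_le.1 (abs_neg_one_pow (n + 1)).le).1
    rw [kurepaP]
    nlinarith

/-- For each even `k = 2n` with `n ≥ 1` and every real `x ≥ k+1`:
`r_k(x) < F(x)/Γ(x+2) ≤ (p_k(x)/(p_k(x)−1))·r_k(x)`, where the right inequality is an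
equality iff `x = k+1`. -/
theorem reAltKurepa_div_gamma_bounds_even (n : ℕ) (hn : 1 ≤ n) (k : ℕ) (hk : k = 2 * n)
    (x : ℝ) (hx : (k : ℝ) + 1 ≤ x) :
    kurepaR k x < reAltKurepa x / Real.Gamma (x + 2) ∧
    reAltKurepa x / Real.Gamma (x + 2) ≤ (kurepaP k x / (kurepaP k x - 1)) * kurepaR k x ∧
    (reAltKurepa x / Real.Gamma (x + 2) = (kurepaP k x / (kurepaP k x - 1)) * kurepaR k x ↔
      x = (k : ℝ) + 1) := by
  obtain ⟨j, rfl⟩ : ∃ j, k = j + 1 := ⟨k - 1, by omega⟩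
  have hodd : Odd j := by
    rw [Nat.odd_iff]
    omega
  push_cast at hx
  have hG : 0 < Real.Gamma (x + 2) := Real.Gamma_pos_of_pos (by linarith [j.cast_nonneg (α := ℝ)])
  have hP : 1 ≤ kurepaP j x := one_le_kurepaP j (by linarith)
  have hD : 0 < ∏ i ∈ Finset.range (j + 1), (x + 1 - (i : ℝ)) :=
    Finset.prod_pos fun i hi => by
      have : (i : ℝ) ≤ j := by exact_mod_cast Nat.lt_succ_iff.1 (Finset.mem_range.1 hi)
      linarith
  have hR := kurepaR_mul_prod j (x := x) (by linarith)
  have h1 := reAltKurepa_eq_Gamma_mul_add j (x := x) (by linarith)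
  have h2 := reAltKurepa_eq_Gamma_mul_add (j + 1) (x := x) (by push_cast; linarith)
  rw [hodd.add_one.neg_one_pow, one_mul, ← eq_div_iff hD.ne'] at hR
  rw [hodd.neg_one_pow, ← hR] at h1
  rw [hodd.add_one.neg_one_pow, Finset.prod_range_succ] at h2
  have hPs : kurepaP (j + 1) x = (x - j) * kurepaP j x + 1 := by
    rw [kurepaP, hodd.add_one.neg_one_pow]
    ring
  have hq : kurepaP (j + 1) x / (kurepaP (j + 1) x - 1) * kurepaR (j + 1) x = kurepaP (j + 1) x /
      ((∏ i ∈ Finset.range (j + 1), (x + 1 - (i : ℝ))) * (x + 1 - ((j + 1 : ℕ) : ℝ))) := by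
    have hxj : x - j ≠ 0 := by linarith
    have hP0 : kurepaP j x ≠ 0 := by linarith
    have hD0 := hD.ne'
    rw [hR, hPs]
    push_cast
    rw [show x + 1 - ((j : ℝ) + 1) = x - j by ring, add_sub_cancel_right]
    field_simp
  rw [← hq] at h2
  push_cast at h2 ⊢
  rw [lt_div_iff₀ hG, div_le_iff₀ hG, div_eq_iff hG.ne']
  have hpos := reAltKurepa_pos (x := x - j - 1) (by linarith)
  rcases hx.eq_or_lt with he | hlt
  · have h0 : reAltKurepa (x - (j + 1) - 1) = 0 := by
      rw [← he, show (j : ℝ) + 1 + 1 - (j + 1) - 1 = 0 by ring, reAltKurepa_zero]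
    exact ⟨by linarith, by linarith, fun _ => he.symm, fun _ => by linarith⟩
  · have h0 := reAltKurepa_pos (x := x - (j + 1) - 1) (by linarith)
    exact ⟨by linarith, by linarith, fun h => by linarith, fun h => by linarith⟩
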